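/- The alternating Golden exponential series E_F(x) = ∑_{n=0}^∞ (−1)^{n(n−1)/2}·x^n/F_n! converges absolutely for every real x, and for every real constant k and every nonzero real x: (E_F(kφx) − E_F(−kx/φ))/(√5·x) = k·E_F(−kx); that is, D_F E_F(kx) = k·E_F(−kx). -/

import Mathlib

noncomputable def φ : ℝ := (1 + Real.sqrt 5) / 2

/-- The Fibonacci factorial `F_n! = F_1 ⋯ F_n`. -/
noncomputable def fibFact (n : ℕ) : ℝ := ∏ i ∈ Finset.range n, (Nat.fib (i + 1) : ℝ)

/-- The alternating Golden exponential `E_F`. -/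
noncomputable def EF (x : ℝ) : ℝ :=
  ∑' n : ℕ, (-1 : ℝ) ^ (n * (n - 1) / 2) * x ^ n / fibFact n

theorem φ_eq_goldenRatio : φ = Real.goldenRatio := rfl

theorem fibFact_succ (n : ℕ) : fibFact (n + 1) = fibFact n * (Nat.fib (n + 1) : ℝ) :=
  Finset.prod_range_succ _ n

theorem fibFact_pos (n : ℕ) : 0 < fibFact n :=
  Finset.prod_pos fun _ _ => Nat.cast_pos.2 (Nat.fib_pos.2 (Nat.succ_pos _))

theorem neg_one_pow_triangle_succ (n : ℕ) :
    (-1 : ℝ) ^ ((n + 1) * (n + 1 - 1) / 2) = (-1) ^ (n * (n - 1) / 2) * (-1) ^ n := by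
  rw [← pow_add, Nat.triangle_succ]

theorem EF_term_succ (x : ℝ) (n : ℕ) :
    (-1 : ℝ) ^ ((n + 1) * (n + 1 - 1) / 2) * x ^ (n + 1) / fibFact (n + 1) =
      (-1) ^ n * x / (Nat.fib (n + 1) : ℝ) *
        ((-1 : ℝ) ^ (n * (n - 1) / 2) * x ^ n / fibFact n) := by
  rw [neg_one_pow_triangle_succ, fibFact_succ, pow_succ, div_mul_div_comm]
  congr 1 <;> ring

theorem summable_EF (x : ℝ) :
    Summable fun n : ℕ => (-1 : ℝ) ^ (n * (n - 1) / 2) * x ^ n / fibFact n := by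
  refine summable_of_ratio_norm_eventually_le (r := 1 / 2) (by norm_num) ?_
  obtain ⟨N, hN⟩ := exists_nat_ge (2 * |x|)
  filter_upwards [Filter.eventually_ge_atTop (max N 5)] with n hn
  have hfib : 2 * |x| ≤ (Nat.fib (n + 1) : ℝ) := by
    have h : N ≤ Nat.fib (n + 1) := by
      have := Nat.le_fib_self (n := n + 1) (by omega)
      omega
    exact hN.trans (Nat.cast_le.2 h)
  have hpos : (0 : ℝ) < Nat.fib (n + 1) := Nat.cast_pos.2 (Nat.fib_pos.2 n.succ_pos)
  rw [EF_term_succ, norm_mul]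
  refine mul_le_mul_of_nonneg_right ?_ (norm_nonneg _)
  rw [norm_div, norm_mul, norm_pow, norm_neg, norm_one, one_pow, one_mul, Real.norm_eq_abs,
    Real.norm_of_nonneg hpos.le, div_le_iff₀ hpos]
  linarith

/-- Binet's formula makes the Golden difference shift the coefficients of `EF`. -/
theorem EF_term_golden_sub (y : ℝ) (n : ℕ) :
    (-1 : ℝ) ^ ((n + 1) * (n + 1 - 1) / 2) * (φ * y) ^ (n + 1) / fibFact (n + 1) -
        (-1 : ℝ) ^ ((n + 1) * (n + 1 - 1) / 2) * (Real.goldenConj * y) ^ (n + 1) /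
          fibFact (n + 1) =
      Real.sqrt 5 * y * ((-1 : ℝ) ^ (n * (n - 1) / 2) * (-y) ^ n / fibFact n) := by
  have hfib : (Nat.fib (n + 1) : ℝ) ≠ 0 := Nat.cast_ne_zero.2 (Nat.fib_pos.2 n.succ_pos).ne'
  have hfact := (fibFact_pos n).ne'
  have h5 : Real.sqrt 5 ≠ 0 := by positivity
  have hbinet : φ ^ (n + 1) - Real.goldenConj ^ (n + 1) = Real.sqrt 5 * Nat.fib (n + 1) := by
    rw [Real.coe_fib_eq, φ_eq_goldenRatio, mul_div_cancel₀ _ h5]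
  rw [neg_one_pow_triangle_succ, fibFact_succ, ← sub_div, ← mul_sub, mul_pow, mul_pow, ← sub_mul,
    hbinet, neg_pow y, pow_succ' y]
  field_simp

theorem EF_golden_sub (y : ℝ) :
    EF (φ * y) - EF (Real.goldenConj * y) = Real.sqrt 5 * y * EF (-y) := by
  unfold EF
  rw [← (summable_EF _).tsum_sub (summable_EF _),
    ((summable_EF _).sub (summable_EF _)).tsum_eq_zero_add, ← tsum_mul_left]
  simp only [EF_term_golden_sub]
  simp

theorem alt_golden_exponential_derivative :
    (∀ x : ℝ, Summable fun n : ℕ => |(-1 : ℝ) ^ (n * (n - 1) / 2) * x ^ n / fibFact n|) ∧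
    (∀ k : ℝ, ∀ x : ℝ, x ≠ 0 →
      (EF (k * (φ * x)) - EF (k * (-x / φ))) / (Real.sqrt 5 * x) = k * EF (-(k * x))) := by
  refine ⟨fun x => (summable_EF x).abs, fun k x hx => ?_⟩
  have hconj : k * (-x / φ) = Real.goldenConj * (k * x) := by
    rw [div_eq_mul_inv, φ_eq_goldenRatio, Real.inv_goldenRatio]
    ring
  have h5 : Real.sqrt 5 ≠ 0 := by positivity
  rw [hconj, mul_left_comm k φ x, EF_golden_sub]
  field_simp
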